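/- A real Banach space E is Fraïssé if and only if E is approximately ultrahomogeneous (AUH) and ω-categorical, where ω-categoricity is expressed by total boundedness of the orbit pseudometric: for every n ∈ ℕ and every ε > 0 there is a finite subset F of S_E^n such that every x ∈ S_E^n satisfies d(x,y) < ε for some y ∈ F. -/

import Mathlib

noncomputable section

open Module

/-- `φ` is a `δ`-isometry (a member of `Emb_δ(X,E)`). -/
def IsEmb {E X : Type*} [NormedAddCommGroup E] [NormedSpace ℝ E]
    [NormedAddCommGroup X] [NormedSpace ℝ X] (δ : ℝ) (φ : X →L[ℝ] E) : Prop :=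
  ∀ x : X, (1 + δ)⁻¹ * ‖x‖ ≤ ‖φ x‖ ∧ ‖φ x‖ ≤ (1 + δ) * ‖x‖

/-- `E` is Fraïssé. -/
def Fraisse (E : Type*) [NormedAddCommGroup E] [NormedSpace ℝ E] : Prop :=
  ∀ ε > (0 : ℝ), ∀ k : ℕ, ∃ δ > (0 : ℝ), ∀ (X : Subspace ℝ E),
    FiniteDimensional ℝ X → finrank ℝ X = k →
    ∀ φ ψ : X →L[ℝ] E, IsEmb δ φ → IsEmb δ ψ →
      ∃ T : E ≃ₗᵢ[ℝ] E, ‖T.toLinearIsometry.toContinuousLinearMap.comp φ - ψ‖ < ε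

/-- `E` is approximately ultrahomogeneous (AUH). -/
def AUH (E : Type*) [NormedAddCommGroup E] [NormedSpace ℝ E] : Prop :=
  ∀ (X : Subspace ℝ E), FiniteDimensional ℝ X → ∀ ε > (0 : ℝ),
    ∀ φ ψ : X →ₗᵢ[ℝ] E, ∃ T : E ≃ₗᵢ[ℝ] E,
      ‖T.toLinearIsometry.toContinuousLinearMap.comp φ.toContinuousLinearMap
        - ψ.toContinuousLinearMap‖ < ε

/-- The orbit pseudometric on `n`-tuples:
`d(x,y) = inf_{T ∈ Isom(E)} (Σᵢ ‖T xᵢ − yᵢ‖²)^{1/2}`. -/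
def orbitDist {E : Type*} [NormedAddCommGroup E] [NormedSpace ℝ E]
    (n : ℕ) (x y : Fin n → E) : ℝ :=
  ⨅ T : E ≃ₗᵢ[ℝ] E, Real.sqrt (∑ i, ‖T (x i) - y i‖ ^ 2)

open Filter Topology

/-- The tuples `x` and `y` are uniformly `ε`-close up to a linear isometry of `E`. -/
def OrbitClose {E ι : Type*} [NormedAddCommGroup E] [NormedSpace ℝ E]
    (ε : ℝ) (x y : ι → E) : Prop :=
  ∃ T : E ≃ₗᵢ[ℝ] E, ∀ i, ‖T (x i) - y i‖ < ε

section

variable {E ι α : Type*} [NormedAddCommGroup E] [NormedSpace ℝ E]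

theorem OrbitClose.mono {ε ε' : ℝ} {x y : ι → E} (h : OrbitClose ε x y) (hε : ε ≤ ε') :
    OrbitClose ε' x y :=
  let ⟨T, hT⟩ := h
  ⟨T, fun i => (hT i).trans_le hε⟩

theorem OrbitClose.symm {ε : ℝ} {x y : ι → E} (h : OrbitClose ε x y) : OrbitClose ε y x := by
  obtain ⟨T, hT⟩ := h
  refine ⟨T.symm, fun i => ?_⟩
  rw [← T.norm_map, map_sub, T.apply_symm_apply, norm_sub_rev]
  exact hT i

theorem OrbitClose.trans {ε ε' : ℝ} {x y z : ι → E} (h : OrbitClose ε x y)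
    (h' : OrbitClose ε' y z) : OrbitClose (ε + ε') x z := by
  obtain ⟨T, hT⟩ := h
  obtain ⟨S, hS⟩ := h'
  refine ⟨T.trans S, fun i => ?_⟩
  have h1 : ‖S (T (x i)) - S (y i)‖ < ε := by
    rw [← map_sub, S.norm_map]
    exact hT i
  calc ‖S (T (x i)) - z i‖ ≤ ‖S (T (x i)) - S (y i)‖ + ‖S (y i) - z i‖ :=
        norm_sub_le_norm_sub_add_norm_sub _ _ _
    _ < ε + ε' := add_lt_add h1 (hS i)

theorem OrbitClose.of_norm_sub_lt {ε : ℝ} {x y : ι → E} (h : ∀ i, ‖x i - y i‖ < ε) :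
    OrbitClose ε x y :=
  ⟨LinearIsometryEquiv.refl ℝ E, h⟩

theorem OrbitClose.of_orbitDist_lt {n : ℕ} {ε : ℝ} {x y : Fin n → E}
    (h : orbitDist n x y < ε) : OrbitClose ε x y := by
  obtain ⟨T, hT⟩ := exists_lt_of_ciInf_lt h
  refine ⟨T, fun i => lt_of_le_of_lt (Real.le_sqrt_of_sq_le ?_) hT⟩
  exact Finset.single_le_sum (f := fun i => ‖T (x i) - y i‖ ^ 2) (fun i _ => sq_nonneg _)
    (Finset.mem_univ i)

theorem OrbitClose.orbitDist_le {n : ℕ} {ε : ℝ} {x y : Fin n → E} (hε : 0 ≤ ε)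
    (h : OrbitClose ε x y) : orbitDist n x y ≤ n * ε := by
  obtain ⟨T, hT⟩ := h
  have hbdd : BddBelow (Set.range fun T : E ≃ₗᵢ[ℝ] E =>
      Real.sqrt (∑ i, ‖T (x i) - y i‖ ^ 2)) := by
    refine ⟨0, ?_⟩
    rintro _ ⟨S, rfl⟩
    exact Real.sqrt_nonneg _
  refine (ciInf_le hbdd T).trans (Real.sqrt_le_iff.2 ⟨by positivity, ?_⟩)
  calc ∑ i, ‖T (x i) - y i‖ ^ 2 ≤ ∑ _i : Fin n, ε ^ 2 :=
        Finset.sum_le_sum fun i _ => pow_le_pow_left₀ (norm_nonneg _) (hT i).le 2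
    _ = n * ε ^ 2 := by simp
    _ ≤ (n * ε) ^ 2 := by
        have : (n : ℝ) ≤ (n : ℝ) ^ 2 := by
          exact_mod_cast Nat.le_self_pow two_ne_zero n
        nlinarith [sq_nonneg ε]

/-- Total boundedness of the orbit pseudometric makes every ultrafilter of unit tuples converge
up to isometries. -/
theorem exists_forall_eventually_orbitClose [CompleteSpace E] {n : ℕ}
    (H : ∀ ε > (0 : ℝ), ∃ F : Set (Fin n → E), F.Finite ∧
      ∀ x : Fin n → E, (∀ i, ‖x i‖ = 1) → ∃ y ∈ F, orbitDist n x y < ε)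
    (l : Ultrafilter α) (x : α → Fin n → E) (hx : ∀ t i, ‖x t i‖ = 1) :
    ∃ u : Fin n → E, ∀ ε > 0, ∀ᶠ t in l, OrbitClose ε (x t) u := by
  have hnet : ∀ k : ℕ, ∃ y : Fin n → E, ∀ᶠ t in l, OrbitClose ((1 / 2 : ℝ) ^ k) (x t) y := by
    intro k
    obtain ⟨F, hF, hFx⟩ := H ((1 / 2 : ℝ) ^ k) (by positivity)
    have : ∀ᶠ t in l, ∃ y ∈ F, OrbitClose ((1 / 2 : ℝ) ^ k) (x t) y :=
      Eventually.of_forall fun t =>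
        let ⟨y, hy, hd⟩ := hFx (x t) (hx t)
        ⟨y, hy, .of_orbitDist_lt hd⟩
    obtain ⟨y, -, hy⟩ := (Ultrafilter.eventually_exists_mem_iff hF).1 this
    exact ⟨y, hy⟩
  choose Y hY using hnet
  have hstep : ∀ k, OrbitClose (2 * (1 / 2 : ℝ) ^ k) (Y k) (Y (k + 1)) := by
    intro k
    obtain ⟨t, h1, h2⟩ := ((hY k).and (hY (k + 1))).exists
    refine (h1.symm.trans h2).mono ?_
    rw [pow_succ]
    have : (0 : ℝ) < (1 / 2) ^ k := by positivity
    linarith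
  choose T hT using hstep
  let S : ℕ → (E ≃ₗᵢ[ℝ] E) := fun k =>
    Nat.rec (LinearIsometryEquiv.refl ℝ E) (fun k S => (T k).symm.trans S) k
  have hS : ∀ k v, S (k + 1) v = S k ((T k).symm v) := fun k v => rfl
  have hdist : ∀ i k, dist (S k (Y k i)) (S (k + 1) (Y (k + 1) i)) ≤ 2 * (1 / 2 : ℝ) ^ k := by
    intro i k
    rw [hS, (S k).dist_map, ← (T k).dist_map, (T k).apply_symm_apply, dist_eq_norm]
    exact (hT k i).le
  have hlim : ∀ i, ∃ v, Tendsto (fun k => S k (Y k i)) atTop (𝓝 v) := fun i =>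
    cauchySeq_tendsto_of_complete (cauchySeq_of_le_geometric _ _ (by norm_num) (hdist i))
  choose u hu using hlim
  refine ⟨u, fun ε hε => ?_⟩
  have h1 : ∀ᶠ k in atTop, (1 / 2 : ℝ) ^ k < ε / 2 :=
    (tendsto_pow_atTop_nhds_zero_of_lt_one (by norm_num) (by norm_num)).eventually_lt_const
      (half_pos hε)
  have h2 : ∀ᶠ k in atTop, ∀ i, ‖S k (Y k i) - u i‖ < ε / 2 := by
    refine eventually_all.2 fun i => ?_
    filter_upwards [Metric.tendsto_nhds.1 (hu i) (ε / 2) (half_pos hε)] with k hk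
    rwa [← dist_eq_norm]
  obtain ⟨k, hk1, hk2⟩ := (h1.and h2).exists
  filter_upwards [hY k] with t ht
  have : OrbitClose (ε / 2) (Y k) u := ⟨S k, hk2⟩
  exact ((ht.mono hk1.le).trans this).mono (by linarith)

/-- Every finite-dimensional real normed space has an Auerbach basis. -/
theorem exists_auerbach_basis (V : Type*) [NormedAddCommGroup V] [NormedSpace ℝ V]
    [FiniteDimensional ℝ V] :
    ∃ b : Basis (Fin (finrank ℝ V)) ℝ V,
      (∀ i, ‖b i‖ = 1) ∧ ∀ v i, |b.repr v i| ≤ ‖v‖ := by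
  have : ProperSpace V := FiniteDimensional.proper ℝ V
  let e := finBasis ℝ V
  let K : Set (Fin (finrank ℝ V) → V) := Set.univ.pi fun _ => Metric.closedBall 0 1
  have hK : IsCompact K := isCompact_univ_pi fun _ => isCompact_closedBall _ _
  have memK : ∀ v : Fin (finrank ℝ V) → V, v ∈ K ↔ ∀ i, ‖v i‖ ≤ 1 := by
    intro v
    simp [K, Set.mem_pi]
  have hdet : Continuous fun v : Fin (finrank ℝ V) → V => |e.det v| := by
    simp only [Basis.det_apply]
    refine continuous_abs.comp ?_
    refine Continuous.matrix_det (continuous_matrix fun i j => ?_)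
    exact (LinearMap.continuous_of_finiteDimensional (e.coord i)).comp (continuous_apply j)
  obtain ⟨v, hvK, hv⟩ := hK.exists_isMaxOn ⟨0, (memK 0).2 (by simp)⟩ hdet.continuousOn
  have hpos : 0 < |e.det v| := by
    let w : Fin (finrank ℝ V) → V := fun i => ‖e i‖⁻¹ • e i
    have hw : w ∈ K := (memK w).2 fun i => by
      rw [norm_smul, norm_inv, norm_norm, inv_mul_cancel₀ (norm_ne_zero_iff.2 (e.ne_zero i))]
    refine lt_of_lt_of_le (abs_pos.2 ?_) (hv hw)
    have : e.det w = (∏ i, ‖e i‖⁻¹) • e.det e := e.det.map_smul_univ _ _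
    rw [this, e.det_self, smul_eq_mul, mul_one]
    exact Finset.prod_ne_zero_iff.2 fun i _ => inv_ne_zero (norm_ne_zero_iff.2 (e.ne_zero i))
  obtain ⟨hli, hsp⟩ := (Basis.is_basis_iff_det e).2 (isUnit_iff_ne_zero.2 (abs_pos.1 hpos))
  let b := Basis.mk hli hsp.ge
  have hb : ∀ i, b i = v i := fun i => Basis.mk_apply _ _ _
  have hcoord : ∀ w i, |b.repr w i| ≤ ‖w‖ := by
    intro w i
    rcases eq_or_ne w 0 with rfl | hw
    · simp
    have hw0 : 0 < ‖w‖ := norm_pos_iff.2 hw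
    have h1 : e.det v * b.repr (‖w‖⁻¹ • w) i = e.det (Function.update v i (‖w‖⁻¹ • w)) :=
      LinearMap.congr_fun (e.det_smul_mk_coord_eq_det_update hli hsp.ge i) (‖w‖⁻¹ • w)
    have h2 : |e.det (Function.update v i (‖w‖⁻¹ • w))| ≤ |e.det v| := by
      refine hv ((memK _).2 fun j => ?_)
      rcases eq_or_ne j i with rfl | hj
      · simp [norm_smul, hw0.ne']
      · rw [Function.update_of_ne hj]
        exact (memK v).1 hvK j
    rw [← h1, abs_mul, mul_le_iff_le_one_right hpos] at h2
    simpa [abs_mul, inv_mul_le_iff₀ hw0] using h2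
  refine ⟨b, fun i => le_antisymm ?_ ?_, hcoord⟩
  · rw [hb]
    exact (memK v).1 hvK i
  · simpa using hcoord (b i) i

theorem norm_sum_smul_le [Fintype ι] {r : ℝ} (a : ι → ℝ) {v : ι → E} (hv : ∀ i, ‖v i‖ ≤ r) :
    ‖∑ i, a i • v i‖ ≤ (∑ i, |a i|) * r := by
  rw [Finset.sum_mul]
  refine norm_sum_le_of_le _ fun i _ => ?_
  rw [norm_smul, Real.norm_eq_abs]
  exact mul_le_mul_of_nonneg_left (hv i) (abs_nonneg _)

theorem sum_abs_le_card_mul_norm [Fintype ι] (a : ι → ℝ) :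
    ∑ i, |a i| ≤ Fintype.card ι * ‖a‖ := by
  simpa using Finset.sum_le_card_nsmul Finset.univ (fun i => |a i|) ‖a‖
    fun i _ => norm_le_pi_norm a i

theorem abs_norm_sum_smul_sub_le [Fintype ι] {v : ι → E} (hv : ∀ i, ‖v i‖ ≤ 1) (a b : ι → ℝ) :
    |‖∑ i, a i • v i‖ - ‖∑ i, b i • v i‖| ≤ Fintype.card ι * ‖a - b‖ := by
  refine (abs_norm_sub_norm_le _ _).trans ?_
  rw [← Finset.sum_sub_distrib]
  simp only [← sub_smul]
  refine (norm_sum_smul_le (fun i => a i - b i) hv).trans ?_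
  rw [mul_one]
  exact sum_abs_le_card_mul_norm (a - b)

theorem abs_norm_sum_smul_sub_le' [Fintype ι] {r : ℝ} {v w : ι → E} (h : ∀ i, ‖v i - w i‖ ≤ r)
    (a : ι → ℝ) : |‖∑ i, a i • v i‖ - ‖∑ i, a i • w i‖| ≤ (∑ i, |a i|) * r := by
  refine (abs_norm_sub_norm_le _ _).trans ?_
  rw [← Finset.sum_sub_distrib]
  simp only [← smul_sub]
  exact norm_sum_smul_le a h

theorem exists_tendsto_norm_sum_smul [Fintype ι] (l : Ultrafilter α) {x : α → ι → E}
    (hx : ∀ t i, ‖x t i‖ ≤ 1) :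
    ∃ p : (ι → ℝ) → ℝ, ∀ a, Tendsto (fun t => ‖∑ i, a i • x t i‖) l (𝓝 (p a)) := by
  have : ∀ a : ι → ℝ, ∃ c, Tendsto (fun t => ‖∑ i, a i • x t i‖) l (𝓝 c) := by
    intro a
    obtain ⟨c, -, hc⟩ := (isCompact_Icc (a := (0 : ℝ)) (b := ∑ i, |a i|)).ultrafilter_le_nhds
      (l.map fun t => ‖∑ i, a i • x t i‖) (by
        rw [le_principal_iff, Ultrafilter.coe_map, mem_map]
        refine univ_mem' fun t => ⟨norm_nonneg _, ?_⟩
        simpa using norm_sum_smul_le a (hx t))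
    exact ⟨c, hc⟩
  exact ⟨fun a => (this a).choose, fun a => (this a).choose_spec⟩

theorem limit_norm_sum_smul_smul [Fintype ι] {l : Filter α} [l.NeBot] {x : α → ι → E}
    {p : (ι → ℝ) → ℝ} (hp : ∀ a, Tendsto (fun t => ‖∑ i, a i • x t i‖) l (𝓝 (p a)))
    (r : ℝ) (a : ι → ℝ) : p (r • a) = |r| * p a := by
  refine tendsto_nhds_unique (hp _) (((hp a).const_mul |r|).congr fun t => ?_)
  simp only [Pi.smul_apply, smul_assoc, ← Finset.smul_sum, norm_smul, Real.norm_eq_abs]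

/-- If the norms `a ↦ ‖∑ aᵢ xᵢ‖` converge pointwise to a definite function, then they converge
uniformly relative to that limit, which is bounded below by a multiple of the norm. -/
theorem exists_uniform_approx [Fintype ι] {l : Filter α} [l.NeBot] {x : α → ι → E}
    (hx : ∀ t i, ‖x t i‖ ≤ 1) {p : (ι → ℝ) → ℝ}
    (hp : ∀ a, Tendsto (fun t => ‖∑ i, a i • x t i‖) l (𝓝 (p a)))
    (hp0 : ∀ a, p a = 0 → a = 0) :
    ∃ c > 0, (∀ a, c * ‖a‖ ≤ p a) ∧
      ∀ θ > 0, ∀ᶠ t in l, ∀ a, |‖∑ i, a i • x t i‖ - p a| ≤ θ * ‖a‖ := by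
  have hsmul := limit_norm_sum_smul_smul hp
  have hnonneg : ∀ a, 0 ≤ p a := fun a =>
    ge_of_tendsto (hp a) (Eventually.of_forall fun t => norm_nonneg _)
  have hlip : ∀ a b, |p a - p b| ≤ Fintype.card ι * ‖a - b‖ := fun a b =>
    le_of_tendsto ((hp a).sub (hp b)).abs
      (Eventually.of_forall fun t => abs_norm_sum_smul_sub_le (hx t) a b)
  have hcont : Continuous p := by
    have : LipschitzWith (Fintype.card ι : NNReal) p :=
      LipschitzWith.of_dist_le_mul fun a b => by
        rw [Real.dist_eq, dist_eq_norm]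
        exact hlip a b
    exact this.continuous
  have hscale : ∀ a : ι → ℝ, a ≠ 0 → a = ‖a‖ • ‖a‖⁻¹ • a := fun a ha => by
    rw [smul_smul, mul_inv_cancel₀ (norm_ne_zero_iff.2 ha), one_smul]
  have hunit : ∀ a : ι → ℝ, a ≠ 0 → ‖‖a‖⁻¹ • a‖ = 1 := fun a ha => by
    rw [norm_smul, norm_inv, norm_norm, inv_mul_cancel₀ (norm_ne_zero_iff.2 ha)]
  have hzero : p 0 = 0 := by simpa using hsmul 0 0
  have hc : ∃ c > 0, ∀ a, ‖a‖ = 1 → c ≤ p a := by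
    rcases (Metric.sphere (0 : ι → ℝ) 1).eq_empty_or_nonempty with he | hne
    · refine ⟨1, one_pos, fun a ha => ?_⟩
      exact absurd (mem_sphere_zero_iff_norm.2 ha) (by rw [he]; exact Set.notMem_empty a)
    · obtain ⟨a, ha, hmin⟩ := (isCompact_sphere (0 : ι → ℝ) 1).exists_isMinOn hne
        hcont.continuousOn
      refine ⟨p a, (hnonneg a).lt_of_ne' fun h => ?_, fun b hb =>
        hmin (mem_sphere_zero_iff_norm.2 hb)⟩
      have := mem_sphere_zero_iff_norm.1 ha
      rw [hp0 a h, norm_zero] at this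
      exact zero_ne_one this
  obtain ⟨c, hc0, hc⟩ := hc
  refine ⟨c, hc0, fun a => ?_, fun θ hθ => ?_⟩
  · rcases eq_or_ne a 0 with rfl | ha
    · simp [hzero]
    · conv_rhs => rw [hscale a ha, hsmul, abs_norm, mul_comm]
      exact mul_le_mul_of_nonneg_right (hc _ (hunit a ha)) (norm_nonneg _)
  · let N : ℝ := Fintype.card ι
    have hN : 0 ≤ N := Nat.cast_nonneg _
    let η : ℝ := θ / (2 * N + 1)
    have hη : 0 < η := by positivity
    have hηθ : N * η + η + N * η = θ := by
      simp only [η]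
      field_simp
      ring
    obtain ⟨A, -, hA, hcover⟩ :=
      (isCompact_closedBall (0 : ι → ℝ) 1).finite_cover_balls hη
    have hev : ∀ᶠ t in l, ∀ b ∈ A, |‖∑ i, b i • x t i‖ - p b| < η := by
      refine (eventually_all_finite hA).2 fun b _ => ?_
      simpa only [Real.dist_eq] using Metric.tendsto_nhds.1 (hp b) η hη
    filter_upwards [hev] with t ht a
    have hball : ∀ a, ‖a‖ = 1 → |‖∑ i, a i • x t i‖ - p a| ≤ θ := by
      intro a ha
      have := hcover (mem_closedBall_zero_iff.2 ha.le)
      simp only [Set.mem_iUnion, exists_prop] at this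
      obtain ⟨b, hb, hab⟩ := this
      rw [Metric.mem_ball, dist_eq_norm] at hab
      have h1 := abs_norm_sum_smul_sub_le (hx t) a b
      have h2 := ht b hb
      have h3 := hlip a b
      have h4 : N * ‖a - b‖ ≤ N * η := mul_le_mul_of_nonneg_left hab.le hN
      rw [abs_le] at *
      rw [abs_lt] at h2
      constructor <;> linarith [h1.1, h1.2, h2.1, h2.2, h3.1, h3.2]
    rcases eq_or_ne a 0 with rfl | ha
    · simp [hzero]
    · have h1 : ‖∑ i, a i • x t i‖ = ‖a‖ * ‖∑ i, (‖a‖⁻¹ • a) i • x t i‖ := by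
        conv_lhs => rw [hscale a ha]
        simp only [Pi.smul_apply, smul_assoc, ← Finset.smul_sum]
        rw [norm_smul, norm_norm]
      have h2 : p a = ‖a‖ * p (‖a‖⁻¹ • a) := by
        conv_lhs => rw [hscale a ha, hsmul, abs_norm]
      rw [h1, h2, ← mul_sub, abs_mul, abs_norm, mul_comm]
      exact mul_le_mul_of_nonneg_right (hball _ (hunit a ha)) (norm_nonneg _)

/-- In a Fraïssé space, an ultrafilter of tuples whose limit is nondegenerate is Cauchy up to
isometries. -/
theorem Fraisse.exists_mem_forall_orbitClose_of_definite [Fintype ι] (hE : Fraisse E)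
    {l : Filter α} [l.NeBot] {x : α → ι → E}
    (hx : ∀ t i, ‖x t i‖ ≤ 1) {p : (ι → ℝ) → ℝ}
    (hp : ∀ a, Tendsto (fun t => ‖∑ i, a i • x t i‖) l (𝓝 (p a)))
    (hp0 : ∀ a, p a = 0 → a = 0) {ε : ℝ} (hε : 0 < ε) :
    ∃ s ∈ l, ∀ t ∈ s, ∀ t' ∈ s, OrbitClose ε (x t) (x t') := by
  obtain ⟨δ, hδ, hfr⟩ := hE ε hε (Fintype.card ι)
  obtain ⟨c, hc, hlow, happ⟩ := exists_uniform_approx hx hp hp0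
  let θ : ℝ := min (c / 2) (δ * c / 4)
  have hθ : 0 < θ := lt_min (by positivity) (by positivity)
  have hθ1 : θ ≤ c / 2 := min_le_left _ _
  have hθ2 : θ ≤ δ * c / 4 := min_le_right _ _
  refine ⟨_, happ θ hθ, fun t ht t' ht' => ?_⟩
  have hbelow : ∀ s, (∀ a : ι → ℝ, |‖∑ i, a i • x s i‖ - p a| ≤ θ * ‖a‖) →
      ∀ a : ι → ℝ, c / 2 * ‖a‖ ≤ ‖∑ i, a i • x s i‖ := by
    intro s hs a
    have h1 := (abs_le.1 (hs a)).1
    have h2 := mul_le_mul_of_nonneg_right hθ1 (norm_nonneg a)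
    linarith [hlow a]
  have hcomp : ∀ s s', (∀ a : ι → ℝ, |‖∑ i, a i • x s i‖ - p a| ≤ θ * ‖a‖) →
      (∀ a : ι → ℝ, |‖∑ i, a i • x s' i‖ - p a| ≤ θ * ‖a‖) →
      ∀ a : ι → ℝ, ‖∑ i, a i • x s' i‖ ≤ (1 + δ) * ‖∑ i, a i • x s i‖ := by
    intro s s' hs hs' a
    have h1 := (abs_le.1 (hs a)).1
    have h2 := (abs_le.1 (hs' a)).2
    have h3 := mul_le_mul_of_nonneg_right hθ2 (norm_nonneg a)
    have h4 := mul_le_mul_of_nonneg_left (hbelow s hs a) hδ.le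
    linarith
  have hli : LinearIndependent ℝ (x t) := by
    rw [Fintype.linearIndependent_iff]
    intro a ha
    have h1 := hbelow t ht a
    rw [ha, norm_zero] at h1
    have h2 : ‖a‖ = 0 := by nlinarith [norm_nonneg a]
    exact congrFun (norm_eq_zero.1 h2)
  let X : Subspace ℝ E := Submodule.span ℝ (Set.range (x t))
  let b : Basis ι ℝ X := Basis.span hli
  have hb : ∀ i, (b i : E) = x t i :=
    fun i => congrArg Subtype.val (Basis.span_apply hli i)
  have hfin : FiniteDimensional ℝ X := b.finiteDimensional_of_finite
  let ψ : X →L[ℝ] E := LinearMap.toContinuousLinearMap (b.constr ℝ (x t'))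
  have hψ : ∀ w, ψ w = ∑ i, b.repr w i • x t' i := fun w => b.constr_apply_fintype ℝ (x t') w
  have hw : ∀ w : X, ‖w‖ = ‖∑ i, b.repr w i • x t i‖ := by
    intro w
    have : (w : E) = ∑ i, b.repr w i • x t i := by
      conv_lhs => rw [← b.sum_repr w]
      simp only [Submodule.coe_sum, Submodule.coe_smul, hb]
    rw [← this, Submodule.coe_norm]
  have hone : (1 + δ)⁻¹ ≤ 1 := inv_le_one_of_one_le₀ (by linarith)
  have hemb : IsEmb δ X.subtypeL := by
    intro w
    have h1 : ‖X.subtypeL w‖ = ‖w‖ := rfl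
    rw [h1]
    constructor <;> nlinarith [norm_nonneg w]
  have hembψ : IsEmb δ ψ := by
    intro w
    rw [hψ, hw, inv_mul_le_iff₀ (by linarith)]
    exact ⟨hcomp t' t ht' ht _, hcomp t t' ht ht' _⟩
  obtain ⟨T, hT⟩ := hfr X hfin (finrank_span_eq_card hli) X.subtypeL ψ hemb hembψ
  refine ⟨T, fun i => lt_of_le_of_lt ?_ hT⟩
  have h1 := (T.toLinearIsometry.toContinuousLinearMap.comp X.subtypeL - ψ).le_opNorm (b i)
  have h2 : ‖b i‖ ≤ 1 := by
    rw [Submodule.coe_norm, hb]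
    exact hx t i
  have h3 : (T.toLinearIsometry.toContinuousLinearMap.comp X.subtypeL - ψ) (b i) =
      T (x t i) - x t' i := by
    have h4 : ψ (b i) = x t' i := b.constr_basis ℝ (x t') i
    rw [_root_.sub_apply, h4, ← hb i]
    rfl
  rw [h3] at h1
  exact h1.trans (mul_le_of_le_one_right (norm_nonneg _) h2)

/-- In a Fraïssé space, every ultrafilter of tuples in the unit ball is Cauchy up to
isometries. -/
theorem Fraisse.exists_mem_forall_orbitClose {n : ℕ} (hE : Fraisse E) (l : Ultrafilter α)
    {x : α → Fin n → E} (hx : ∀ t i, ‖x t i‖ ≤ 1) {ε : ℝ} (hε : 0 < ε) :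
    ∃ s ∈ l, ∀ t ∈ s, ∀ t' ∈ s, OrbitClose ε (x t) (x t') := by
  classical
  obtain ⟨p, hp⟩ := exists_tendsto_norm_sum_smul l hx
  have hsmul := limit_norm_sum_smul_smul hp
  have hzero : p 0 = 0 := by simpa using hsmul 0 0
  let good : Finset (Fin n) → Prop := fun I =>
    ∀ a : Fin n → ℝ, (∀ i ∉ I, a i = 0) → p a = 0 → a = 0
  have hgood : good ∅ := fun a ha _ => funext fun i => ha i (Finset.notMem_empty i)
  obtain ⟨I, hI, hmax⟩ := (Finset.univ.filter good).exists_maximal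
    ⟨∅, Finset.mem_filter.2 ⟨Finset.mem_univ _, hgood⟩⟩
  have hIgood : good I := (Finset.mem_filter.1 hI).2
  have hdep : ∀ j, ∃ c : Fin n → ℝ, (∀ i ∉ I, c i = 0) ∧ p (Pi.single j 1 - c) = 0 := by
    intro j
    by_cases hj : j ∈ I
    · refine ⟨Pi.single j 1, fun i hi => ?_, by rw [sub_self, hzero]⟩
      exact Pi.single_eq_of_ne (fun h : i = j => hi (h ▸ hj)) 1
    · have hnot : ¬ good (insert j I) := fun h => hj <|
        hmax (Finset.mem_filter.2 ⟨Finset.mem_univ _, h⟩) (Finset.subset_insert j I)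
          (Finset.mem_insert_self j I)
      simp only [good] at hnot
      push Not at hnot
      obtain ⟨a, ha, hpa, ha0⟩ := hnot
      have haj : a j ≠ 0 := fun h => ha0 <| hIgood a (fun i hi => by
        by_cases hij : i = j
        · rw [hij, h]
        · exact ha i (by simp [hij, hi])) hpa
      refine ⟨Pi.single j 1 - (a j)⁻¹ • a, fun i hi => ?_, ?_⟩
      · by_cases hij : i = j
        · subst hij
          simp [haj]
        · simp [hij, ha i (by simp [hij, hi])]
      · rw [sub_sub_cancel, hsmul, hpa, mul_zero]
  choose c hcI hc using hdep
  let ext : (I → ℝ) → Fin n → ℝ := fun a i => if h : i ∈ I then a ⟨i, h⟩ else 0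
  have hext : ∀ (v : Fin n → E) (a : I → ℝ), ∑ i, ext a i • v i = ∑ i : I, a i • v i := by
    intro v a
    rw [← Finset.sum_subset (Finset.subset_univ I) fun i _ hi => by simp [ext, hi],
      ← Finset.sum_coe_sort]
    exact Finset.sum_congr rfl fun i _ => by simp [ext]
  let C : ℝ := ∑ j, ∑ i, |c j i|
  have hC : 0 ≤ C := by positivity
  let η : ℝ := ε / (C + 3)
  have hη : 0 < η := by positivity
  have hηε : η + C * η + η < ε := by
    have : (C + 3) * η = ε := mul_div_cancel₀ _ (by positivity)
    linarith
  obtain ⟨s, hs, hsclose⟩ := hE.exists_mem_forall_orbitClose_of_definite (l := (l : Filter α))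
    (x := fun t (i : I) => x t i)
    (fun t i => hx t i) (p := fun a => p (ext a))
    (fun a => by simpa only [hext] using hp (ext a))
    (fun a ha => by
      have := hIgood (ext a) (fun i hi => by simp [ext, hi]) ha
      funext i
      simpa [ext] using congrFun this i) hη
  have hsmall : ∀ᶠ t in (l : Filter α), ∀ j,
      ‖∑ i, (Pi.single j 1 - c j : Fin n → ℝ) i • x t i‖ < η :=
    eventually_all.2 fun j => (hp _).eventually_lt_const (by rwa [hc j])
  refine ⟨_, inter_mem hs hsmall, ?_⟩
  rintro t ⟨ht, htj⟩ t' ⟨ht', htj'⟩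
  obtain ⟨T, hT⟩ := hsclose t ht t' ht'
  refine ⟨T, fun j => lt_of_le_of_lt ?_ hηε⟩
  have hsum : ∀ v : Fin n → E,
      ∑ i, (Pi.single j 1 - c j : Fin n → ℝ) i • v i = v j - ∑ i, c j i • v i := by
    intro v
    simp only [Pi.sub_apply, sub_smul, Finset.sum_sub_distrib]
    simp [Pi.single_apply]
  have h1 : ‖T (x t j - ∑ i, c j i • x t i)‖ ≤ η := by
    rw [T.norm_map, ← hsum]
    exact (htj j).le
  have h2 : ‖x t' j - ∑ i, c j i • x t' i‖ ≤ η := by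
    rw [← hsum]
    exact (htj' j).le
  have h3 : ‖∑ i, c j i • (T (x t i) - x t' i)‖ ≤ C * η := by
    calc ‖∑ i, c j i • (T (x t i) - x t' i)‖ ≤ ∑ i, |c j i| * η := by
          refine norm_sum_le_of_le _ fun i _ => ?_
          rw [norm_smul, Real.norm_eq_abs]
          by_cases hi : i ∈ I
          · exact mul_le_mul_of_nonneg_left (hT ⟨i, hi⟩).le (abs_nonneg _)
          · simp [hcI j i hi]
      _ = (∑ i, |c j i|) * η := by rw [Finset.sum_mul]
      _ ≤ C * η := mul_le_mul_of_nonneg_right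
          (Finset.single_le_sum (f := fun j => ∑ i, |c j i|) (fun j _ => by positivity)
            (Finset.mem_univ j)) hη.le
  have h4 : T (x t j) - x t' j = T (x t j - ∑ i, c j i • x t i) +
      ∑ i, c j i • (T (x t i) - x t' i) - (x t' j - ∑ i, c j i • x t' i) := by
    simp only [map_sub, map_sum, map_smul, smul_sub, Finset.sum_sub_distrib]
    abel
  rw [h4]
  exact (norm_sub_le _ _).trans (add_le_add ((norm_add_le _ _).trans (add_le_add h1 h3)) h2)

theorem Fraisse.auh (hE : Fraisse E) : AUH E := by
  intro X hX ε hε φ ψ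
  obtain ⟨δ, hδ, h⟩ := hE ε hε (finrank ℝ X)
  have hemb : ∀ χ : X →ₗᵢ[ℝ] E, IsEmb δ χ.toContinuousLinearMap := by
    intro χ w
    have h1 : ‖χ.toContinuousLinearMap w‖ = ‖w‖ := χ.norm_map w
    have h2 : (1 + δ)⁻¹ ≤ 1 := inv_le_one_of_one_le₀ (by linarith)
    rw [h1]
    constructor <;> nlinarith [norm_nonneg w]
  exact h X hX rfl _ _ (hemb φ) (hemb ψ)

theorem Fraisse.totallyBounded_orbitDist (hE : Fraisse E) (n : ℕ) {ε : ℝ} (hε : 0 < ε) :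
    ∃ F : Set (Fin n → E), F.Finite ∧ (∀ y ∈ F, ∀ i, ‖y i‖ = 1) ∧
      ∀ x : Fin n → E, (∀ i, ‖x i‖ = 1) → ∃ y ∈ F, orbitDist n x y < ε := by
  by_contra hcon
  let α := {x : Fin n → E // ∀ i, ‖x i‖ = 1}
  let small : Set α → Prop := fun s =>
    ∃ F : Set α, F.Finite ∧ ∀ x ∈ s, ∃ y ∈ F, orbitDist n x.1 y.1 < ε
  let f : Filter α := Filter.comk small ⟨∅, Set.finite_empty, by simp⟩
    (fun s ⟨F, hF, hs⟩ t hts => ⟨F, hF, fun x hx => hs x (hts hx)⟩)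
    (fun s ⟨F, hF, hs⟩ t ⟨G, hG, ht⟩ => ⟨F ∪ G, hF.union hG, by
      rintro x (hx | hx)
      · obtain ⟨y, hy, h⟩ := hs x hx
        exact ⟨y, .inl hy, h⟩
      · obtain ⟨y, hy, h⟩ := ht x hx
        exact ⟨y, .inr hy, h⟩⟩)
  have hf : f.NeBot := by
    refine ⟨fun hbot => hcon ?_⟩
    have hempty : (∅ : Set α) ∈ f := hbot ▸ Filter.mem_bot
    obtain ⟨F, hF, hs⟩ := Filter.mem_comk.1 hempty
    refine ⟨Subtype.val '' F, hF.image _, ?_, fun x hx => ?_⟩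
    · rintro _ ⟨y, -, rfl⟩
      exact y.2
    · obtain ⟨y, hy, h⟩ := hs ⟨x, hx⟩ (by simp)
      exact ⟨y, ⟨y, hy, rfl⟩, h⟩
  obtain ⟨l, hl⟩ := Ultrafilter.exists_le f
  obtain ⟨s, hs, hclose⟩ := hE.exists_mem_forall_orbitClose l (x := fun t : α => t.1)
    (fun t i => (t.2 i).le) (ε := ε / (n + 1)) (by positivity)
  obtain ⟨y, hy⟩ := l.nonempty_of_mem hs
  have hfar : {x : α | ¬ orbitDist n x.1 y.1 < ε} ∈ l :=
    hl (Filter.mem_comk.2 ⟨{y}, Set.finite_singleton y, fun x hx =>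
      ⟨y, rfl, by simpa using hx⟩⟩)
  obtain ⟨x, hxs, hxy⟩ := l.nonempty_of_mem (inter_mem hs hfar)
  refine hxy (((hclose x hxs y hy).orbitDist_le (by positivity)).trans_lt ?_)
  rw [mul_div_assoc', div_lt_iff₀ (by positivity)]
  nlinarith

/-- In an approximately ultrahomogeneous space, linearly independent tuples spanning isometric
configurations are arbitrarily close up to isometries. -/
theorem AUH.orbitClose [Fintype ι] (hE : AUH E) {u v : ι → E} (hu : ∀ i, ‖u i‖ ≤ 1)
    (hli : LinearIndependent ℝ u) (huv : ∀ a : ι → ℝ, ‖∑ i, a i • v i‖ = ‖∑ i, a i • u i‖)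
    {ε : ℝ} (hε : 0 < ε) : OrbitClose ε u v := by
  let X : Subspace ℝ E := Submodule.span ℝ (Set.range u)
  let b : Basis ι ℝ X := Basis.span hli
  have hb : ∀ i, (b i : E) = u i :=
    fun i => congrArg Subtype.val (Basis.span_apply hli i)
  have hfin : FiniteDimensional ℝ X := b.finiteDimensional_of_finite
  let ψ : X →ₗᵢ[ℝ] E :=
    { b.constr ℝ v with
      norm_map' := fun w => by
        have h1 : (w : E) = ∑ i, b.repr w i • u i := by
          conv_lhs => rw [← b.sum_repr w]
          simp only [Submodule.coe_sum, Submodule.coe_smul, hb]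
        have h2 : b.constr ℝ v w = ∑ i, b.repr w i • v i := b.constr_apply_fintype ℝ v w
        change ‖b.constr ℝ v w‖ = ‖w‖
        rw [h2, huv, ← h1, Submodule.coe_norm] }
  have hψ : ∀ i, ψ (b i) = v i := fun i => b.constr_basis ℝ v i
  obtain ⟨T, hT⟩ := hE X hfin ε hε X.subtypeₗᵢ ψ
  refine ⟨T, fun i => lt_of_le_of_lt ?_ hT⟩
  have h1 := (T.toLinearIsometry.toContinuousLinearMap.comp X.subtypeₗᵢ.toContinuousLinearMap
    - ψ.toContinuousLinearMap).le_opNorm (b i)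
  have h2 : ‖b i‖ ≤ 1 := by
    rw [Submodule.coe_norm, hb]
    exact hu i
  have h3 : (T.toLinearIsometry.toContinuousLinearMap.comp X.subtypeₗᵢ.toContinuousLinearMap
      - ψ.toContinuousLinearMap) (b i) = T (u i) - v i := by
    rw [_root_.sub_apply, ← hψ, ← hb i]
    rfl
  rw [h3] at h1
  exact h1.trans (mul_le_of_le_one_right (norm_nonneg _) h2)

theorem IsEmb.abs_norm_sub_le {X : Type*} [NormedAddCommGroup X] [NormedSpace ℝ X] {δ : ℝ}
    (hδ : 0 ≤ δ) {φ : X →L[ℝ] E} (hφ : IsEmb δ φ) (w : X) : |‖φ w‖ - ‖w‖| ≤ δ * ‖w‖ := by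
  obtain ⟨h1, h2⟩ := hφ w
  have h3 : 1 - δ ≤ (1 + δ)⁻¹ := by
    rw [← one_div, le_div_iff₀ (by linarith)]
    nlinarith [sq_nonneg δ]
  rw [abs_le]
  constructor <;> nlinarith [norm_nonneg w]

/-- The images of a tuple of unit vectors under almost isometric embeddings converge, up to
isometries, to a tuple with the same limiting norms. -/
theorem exists_limit_of_isEmb [CompleteSpace E] {n : ℕ}
    (H : ∀ ε > (0 : ℝ), ∃ F : Set (Fin n → E), F.Finite ∧
      ∀ x : Fin n → E, (∀ i, ‖x i‖ = 1) → ∃ y ∈ F, orbitDist n x y < ε)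
    (l : Ultrafilter α) {δ : α → ℝ} (hδ : ∀ t, 0 < δ t) (hδ0 : Tendsto δ l (𝓝 0))
    {X : α → Subspace ℝ E} (φ : ∀ t, X t →L[ℝ] E) (hφ : ∀ t, IsEmb (δ t) (φ t))
    (x : ∀ t, Fin n → X t) (hx : ∀ t i, ‖x t i‖ = 1) :
    ∃ u : Fin n → E, (∀ i, ‖u i‖ ≤ 1) ∧
      (∀ ε > 0, ∀ᶠ t in l, OrbitClose ε (fun i => φ t (x t i)) u) ∧
      ∀ a : Fin n → ℝ, Tendsto (fun t => ‖∑ i, a i • x t i‖) l (𝓝 ‖∑ i, a i • u i‖) := by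
  have hdiff : ∀ t i, |‖φ t (x t i)‖ - 1| ≤ δ t := fun t i => by
    simpa [hx] using (hφ t).abs_norm_sub_le (hδ t).le (x t i)
  have hne : ∀ t i, ‖φ t (x t i)‖ ≠ 0 := fun t i => by
    have h1 := (hφ t (x t i)).1
    have h2 : 0 < (1 + δ t)⁻¹ := inv_pos.2 (by linarith [hδ t])
    rw [hx, mul_one] at h1
    exact (h2.trans_le h1).ne'
  let y : α → Fin n → E := fun t i => ‖φ t (x t i)‖⁻¹ • φ t (x t i)
  have hy : ∀ t i, ‖y t i‖ = 1 := fun t i => by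
    simp only [y]
    rw [norm_smul, norm_inv, norm_norm, inv_mul_cancel₀ (hne t i)]
  have hyφ : ∀ t i, ‖φ t (x t i) - y t i‖ ≤ δ t := fun t i => by
    have : φ t (x t i) - y t i = (‖φ t (x t i)‖ - 1) • y t i := by
      simp only [y]
      rw [sub_smul, smul_smul, mul_inv_cancel₀ (hne t i), one_smul, one_smul]
    rw [this, norm_smul, hy, mul_one]
    exact hdiff t i
  obtain ⟨u, hu⟩ := exists_forall_eventually_orbitClose H l y hy
  have hclose : ∀ ε > 0, ∀ᶠ t in l, OrbitClose ε (fun i => φ t (x t i)) u := by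
    intro ε hε
    filter_upwards [hu (ε / 2) (half_pos hε), hδ0.eventually_lt_const (half_pos hε)] with t h1 h2
    have h3 : OrbitClose (ε / 2) (fun i => φ t (x t i)) (y t) :=
      .of_norm_sub_lt fun i => (hyφ t i).trans_lt h2
    exact (h3.trans h1).mono (by linarith)
  have hnorm : ∀ a : Fin n → ℝ,
      Tendsto (fun t => ‖∑ i, a i • x t i‖) l (𝓝 ‖∑ i, a i • u i‖) := by
    intro a
    rw [Metric.tendsto_nhds]
    intro ε hε
    let A := ∑ i, |a i|
    have hA : 0 ≤ A := by positivity
    have hη : 0 < ε / (2 * A + 1) := by positivity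
    filter_upwards [hclose _ hη, hδ0.eventually_lt_const hη] with t ⟨T, hT⟩ ht
    have h1 := abs_norm_sum_smul_sub_le' (fun i => (hT i).le) a
    have h2 : ‖∑ i, a i • T (φ t (x t i))‖ = ‖φ t (∑ i, a i • x t i)‖ := by
      rw [← T.norm_map (φ t _)]
      simp only [map_sum, map_smul]
    have h3 := (hφ t).abs_norm_sub_le (hδ t).le (∑ i, a i • x t i)
    have h4 : ‖∑ i, a i • x t i‖ ≤ A := by
      simpa using norm_sum_smul_le a fun i => (hx t i).le
    have h5 : δ t * ‖∑ i, a i • x t i‖ ≤ ε / (2 * A + 1) * A :=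
      mul_le_mul ht.le h4 (norm_nonneg _) hη.le
    have h6 : ε / (2 * A + 1) * A + A * (ε / (2 * A + 1)) < ε := by
      have : ε / (2 * A + 1) * (2 * A + 1) = ε := div_mul_cancel₀ _ (by positivity)
      linarith
    rw [h2] at h1
    rw [Real.dist_eq, abs_lt]
    rw [abs_le] at h1 h3
    constructor <;> linarith [h1.1, h1.2, h3.1, h3.2]
  refine ⟨u, fun i => ?_, hclose, hnorm⟩
  have h := hnorm (Pi.single i 1)
  simp only [Pi.single_apply, ite_smul, one_smul, zero_smul, Finset.sum_ite_eq',
    Finset.mem_univ, if_true, hx] at h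
  exact (tendsto_nhds_unique h tendsto_const_nhds).le

theorem AUH.fraisse [CompleteSpace E] (hE : AUH E)
    (H : ∀ n : ℕ, ∀ ε > (0 : ℝ), ∃ F : Set (Fin n → E), F.Finite ∧
      ∀ x : Fin n → E, (∀ i, ‖x i‖ = 1) → ∃ y ∈ F, orbitDist n x y < ε) : Fraisse E := by
  intro ε hε k
  by_contra hcon
  push Not at hcon
  let δ : ℕ → ℝ := fun m => 1 / ((m : ℝ) + 1)
  have hδ : ∀ m, 0 < δ m := fun m => by positivity
  let l : Ultrafilter ℕ := Filter.hyperfilter ℕ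
  have hδ0 : Tendsto δ l (𝓝 0) :=
    tendsto_one_div_add_atTop_nhds_zero_nat.mono_left Nat.hyperfilter_le_atTop
  choose X hX hrank φ ψ hφ hψ hbad using fun m => hcon (δ m) (hδ m)
  have hbasis : ∀ m, ∃ b : Basis (Fin k) ℝ (X m),
      (∀ i, ‖b i‖ = 1) ∧ ∀ v i, |b.repr v i| ≤ ‖v‖ := by
    intro m
    have := hX m
    rw [← hrank m]
    exact exists_auerbach_basis (X m)
  choose b hb1 hb using hbasis
  obtain ⟨u, hu1, hu, hunorm⟩ := exists_limit_of_isEmb (H k) l hδ hδ0 φ hφ (fun m => b m) hb1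
  obtain ⟨v, -, hv, hvnorm⟩ := exists_limit_of_isEmb (H k) l hδ hδ0 ψ hψ (fun m => b m) hb1
  have huv : ∀ a : Fin k → ℝ, ‖∑ i, a i • v i‖ = ‖∑ i, a i • u i‖ := fun a =>
    tendsto_nhds_unique (hvnorm a) (hunorm a)
  have hli : LinearIndependent ℝ u := by
    rw [Fintype.linearIndependent_iff]
    intro a ha i
    have h1 : |a i| ≤ ‖∑ i, a i • u i‖ := ge_of_tendsto' (hunorm a) fun m => by
      simpa [Finsupp.single_apply] using hb m (∑ i, a i • b m i) i
    rw [ha, norm_zero] at h1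
    exact abs_nonpos_iff.1 h1
  let η : ℝ := ε / (4 * (k + 1))
  have hη : 0 < η := by positivity
  obtain ⟨m, hm1, hm2⟩ := ((hu η hη).and (hv η hη)).exists
  obtain ⟨T, hT⟩ := (hm1.trans (hE.orbitClose hu1 hli huv hη)).trans hm2.symm
  refine (hbad m T).not_gt (lt_of_le_of_lt
    (ContinuousLinearMap.opNorm_le_bound _ (M := k * (η + η + η)) (by positivity) fun w => ?_) ?_)
  · have h1 : (T.toLinearIsometry.toContinuousLinearMap.comp (φ m) - ψ m) w =
        ∑ i, (b m).repr w i • (T (φ m (b m i)) - ψ m (b m i)) := by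
      conv_lhs => rw [← (b m).sum_repr w]
      rw [map_sum]
      refine Finset.sum_congr rfl fun i _ => ?_
      rw [map_smul]
      rfl
    rw [h1]
    refine (norm_sum_smul_le _ fun i => (hT i).le).trans ?_
    rw [mul_right_comm]
    refine mul_le_mul_of_nonneg_right ?_ (by positivity)
    simpa using Finset.sum_le_card_nsmul Finset.univ (fun i => |(b m).repr w i|) ‖w‖
      fun i _ => hb m w i
  · have : η * (4 * (k + 1)) = ε := div_mul_cancel₀ _ (by positivity)
    nlinarith

end

/-- A real Banach space is Fraïssé if and only if it is approximately ultrahomogeneous and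
`ω`-categorical, the latter being expressed by total boundedness of the orbit pseudometric on
the `n`-tuples of unit vectors. -/
theorem fraisse_iff_AUH_and_omegaCategorical
    (E : Type*) [NormedAddCommGroup E] [NormedSpace ℝ E] [CompleteSpace E] :
    Fraisse E ↔
      (AUH E ∧ ∀ (n : ℕ), ∀ ε > (0 : ℝ),
        ∃ F : Set (Fin n → E), F.Finite ∧ (∀ y ∈ F, ∀ i, ‖y i‖ = 1) ∧
          ∀ x : Fin n → E, (∀ i, ‖x i‖ = 1) →
            ∃ y ∈ F, orbitDist n x y < ε) := by
  refine ⟨fun hE => ⟨hE.auh, fun n ε hε => hE.totallyBounded_orbitDist n hε⟩, ?_⟩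
  rintro ⟨hE, H⟩
  refine hE.fraisse fun n ε hε => ?_
  obtain ⟨F, hF, -, hFx⟩ := H n ε hε
  exact ⟨F, hF, hFx⟩
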